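/- Assume the generative model. Then for any matrix W^0 ∈ ℝ^{n×n} and any Z^1 ∈ ℝ^{n×N} whose columns satisfy Z^1_{(·,j)} = H_s(W^0 P_{(·,j)}) for all j, one has ‖Z^1 − Z*‖_F ≤ 2 ‖W^0 − W*‖_F. -/

import Mathlib

open Matrix MeasureTheory ProbabilityTheory Filter
open scoped Kronecker

noncomputable section

/-- Frobenius norm of a real matrix. -/
def frobNorm {m n : Type*} [Fintype m] [Fintype n] (M : Matrix m n ℝ) : ℝ :=
  Real.sqrt (∑ i, ∑ j, (M i j) ^ 2)

/-- Spectral norm (largest singular value) of a real matrix. -/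
def specNorm {m n : Type*} [Fintype m] [Fintype n] [DecidableEq n] (M : Matrix m n ℝ) : ℝ :=
  ‖LinearMap.toContinuousLinearMap (Matrix.toEuclideanLin M)‖

/-- Smallest singular value of a real matrix (as the infimum of `‖Mᵀ x‖` over unit vectors). -/
def sigmaMin {m n : Type*} [Fintype m] [Fintype n] [DecidableEq m] (M : Matrix m n ℝ) : ℝ :=
  sInf {c : ℝ | ∃ x : EuclideanSpace ℝ m, ‖x‖ = 1 ∧ c = ‖Matrix.toEuclideanLin Mᵀ x‖}

/-- Condition number: ratio of largest to smallest singular value. -/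
def condNum {m n : Type*} [Fintype m] [Fintype n] [DecidableEq m] [DecidableEq n]
    (M : Matrix m n ℝ) : ℝ :=
  specNorm M / sigmaMin M

/-- `D_k`: diagonal matrix with ones on the diagonal except a zero at `(k,k)`. -/
def Dk {n : Type*} [Fintype n] [DecidableEq n] (k : n) : Matrix n n ℝ :=
  Matrix.diagonal (fun i => if i = k then 0 else 1)

/-- `D̃_k`: diagonal matrix with ones at columns in the support of the `k`-th row of `Z`. -/
def Dtil {n N : Type*} [Fintype n] [Fintype N] [DecidableEq N]
    (Z : Matrix n N ℝ) (k : n) : Matrix N N ℝ :=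
  Matrix.diagonal (fun j => if Z k j ≠ 0 then 1 else 0)

/-- `max_{1 ≤ k ≤ n} ‖D_k Z D̃_k‖₂`. -/
def qmax {n N : Type*} [Fintype n] [Fintype N] [DecidableEq n] [DecidableEq N]
    (Z : Matrix n N ℝ) : ℝ :=
  ⨆ k : n, specNorm (Dk k * Z * Dtil Z k)

/-- `z = H_s(v)`: hard thresholding of `v` to its `s` largest-magnitude entries. -/
def IsHardThresh {n : ℕ} (s : ℕ) (v z : Fin n → ℝ) : Prop :=
  ∃ T : Finset (Fin n), T.card = s ∧ (∀ i ∈ T, ∀ j ∉ T, |v j| ≤ |v i|) ∧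
    (∀ i ∈ T, z i = v i) ∧ (∀ i ∉ T, z i = 0)

/-- Euclidean norm of a vector. -/
def l2norm {n : ℕ} (v : Fin n → ℝ) : ℝ := Real.sqrt (∑ i, (v i) ^ 2)

/-- `β(v)`: smallest magnitude among the nonzero entries of `v`. -/
def betaMin {n : ℕ} (v : Fin n → ℝ) : ℝ :=
  sInf {c : ℝ | ∃ i, v i ≠ 0 ∧ c = |v i|}

/-- The constant `C(ε₀)` from the convergence-radius analysis. -/
def Cconst (e : ℝ) : ℝ :=
  2 + 9 * Real.sqrt 2 / (8 * (1 - 2 * e - e ^ 2) ^ ((3 : ℝ) / 2)) + Real.sqrt 2 / (1 - e)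

end
/-- A set on which `f` dominates its values off the set has the largest sum of its cardinality. -/
theorem sum_le_sum_of_card_eq_of_dominates {α : Type*} [DecidableEq α] {f : α → ℝ}
    {S T : Finset α} (hcard : S.card = T.card) (hdom : ∀ i ∈ T, ∀ j ∉ T, f j ≤ f i) :
    ∑ i ∈ S, f i ≤ ∑ i ∈ T, f i := by
  have hd : (S \ T).card = (T \ S).card := Finset.card_sdiff_comm hcard
  have key : ∑ i ∈ S \ T, f i ≤ ∑ i ∈ T \ S, f i := by
    rcases (T \ S).eq_empty_or_nonempty with h | h
    · have h' : S \ T = ∅ := by rw [← Finset.card_eq_zero, hd, h, Finset.card_empty]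
      rw [h, h']
    · obtain ⟨m, hm, hmin⟩ := Finset.exists_min_image (T \ S) f h
      calc ∑ i ∈ S \ T, f i ≤ (S \ T).card • f m :=
            Finset.sum_le_card_nsmul _ _ _ fun i hi =>
              hdom m (Finset.mem_sdiff.mp hm).1 i (Finset.mem_sdiff.mp hi).2
        _ = (T \ S).card • f m := by rw [hd]
        _ ≤ ∑ i ∈ T \ S, f i := Finset.card_nsmul_le_sum _ _ _ hmin
  exact Finset.sum_sdiff_le_sum_sdiff.mp key

/-- Hard thresholding gives a best `s`-sparse approximation. -/
theorem IsHardThresh.sum_sq_sub_le {n s : ℕ} {v z w : Fin n → ℝ} (h : IsHardThresh s v z)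
    (hw : (Finset.univ.filter (fun i => w i ≠ 0)).card = s) :
    ∑ i, (z i - v i) ^ 2 ≤ ∑ i, (v i - w i) ^ 2 := by
  obtain ⟨T, hT, hdom, hon, hoff⟩ := h
  set S := Finset.univ.filter (fun i => w i ≠ 0) with hS
  have hle : ∑ i ∈ S, v i ^ 2 ≤ ∑ i ∈ T, v i ^ 2 :=
    sum_le_sum_of_card_eq_of_dominates (hw.trans hT.symm)
      fun i hi j hj => sq_le_sq.mpr (hdom i hi j hj)
  have hz : ∑ i, (z i - v i) ^ 2 = ∑ i ∈ Tᶜ, v i ^ 2 := by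
    rw [← Finset.sum_add_sum_compl T,
      Finset.sum_eq_zero fun i hi => by rw [hon i hi, sub_self, zero_pow two_ne_zero], zero_add]
    exact Finset.sum_congr rfl fun i hi => by
      rw [hoff i (Finset.mem_compl.mp hi), zero_sub, neg_sq]
  have hv : ∑ i ∈ Sᶜ, v i ^ 2 ≤ ∑ i, (v i - w i) ^ 2 := by
    calc ∑ i ∈ Sᶜ, v i ^ 2 = ∑ i ∈ Sᶜ, (v i - w i) ^ 2 :=
          Finset.sum_congr rfl fun i hi => by
            have : w i = 0 := by simpa [hS] using hi
            rw [this, sub_zero]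
      _ ≤ ∑ i, (v i - w i) ^ 2 :=
          Finset.sum_le_sum_of_subset_of_nonneg (Finset.subset_univ _)
            fun i _ _ => sq_nonneg _
  have h1 := Finset.sum_add_sum_compl S fun i => v i ^ 2
  have h2 := Finset.sum_add_sum_compl T fun i => v i ^ 2
  linarith

theorem specNorm_transpose {m n : Type*} [Fintype m] [Fintype n] [DecidableEq m] [DecidableEq n]
    (M : Matrix m n ℝ) : specNorm Mᵀ = specNorm M := by
  simpa [Matrix.conjTranspose_eq_transpose_of_trivial, Matrix.l2_opNorm_def, specNorm]
    using Matrix.l2_opNorm_conjTranspose M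

theorem sum_sq_mulVec_le {m n : Type*} [Fintype m] [Fintype n] [DecidableEq n]
    (M : Matrix m n ℝ) (x : n → ℝ) :
    ∑ i, (M *ᵥ x) i ^ 2 ≤ specNorm M ^ 2 * ∑ j, x j ^ 2 := by
  have h := (LinearMap.toContinuousLinearMap (Matrix.toEuclideanLin M)).le_opNorm (WithLp.toLp 2 x)
  have h2 := pow_le_pow_left₀ (norm_nonneg _) h 2
  rw [mul_pow, EuclideanSpace.real_norm_sq_eq, EuclideanSpace.real_norm_sq_eq] at h2
  exact h2

/-- `‖A B‖_F² ≤ ‖B‖₂² ‖A‖_F²`. -/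
theorem sum_sq_mul_le {l m n : Type*} [Fintype l] [Fintype m] [Fintype n] [DecidableEq m]
    [DecidableEq n] (A : Matrix l m ℝ) (B : Matrix m n ℝ) :
    ∑ i, ∑ j, (A * B) i j ^ 2 ≤ specNorm B ^ 2 * ∑ i, ∑ j, A i j ^ 2 := by
  rw [Finset.mul_sum, ← specNorm_transpose]
  refine Finset.sum_le_sum fun i _ => ?_
  have h := sum_sq_mulVec_le Bᵀ (A i)
  rw [Matrix.mulVec_transpose] at h
  exact h

/-- sparse-coding error bound for an arbitrary initialization. -/
theorem stmt18 (n N s : ℕ) (hs : 1 ≤ s) (hsn : s ≤ n)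
    (Wstar : Matrix (Fin n) (Fin n) ℝ) (Zstar P : Matrix (Fin n) (Fin N) ℝ)
    (hWorth : Wstarᵀ * Wstar = 1)
    (hP : P = Wstarᵀ * Zstar)
    (hPnorm : specNorm P = 1)
    (hcols : ∀ j, (Finset.univ.filter (fun i => Zstar i j ≠ 0)).card = s)
    (W0 : Matrix (Fin n) (Fin n) ℝ) (Z1 : Matrix (Fin n) (Fin N) ℝ)
    (hZ1 : ∀ j, IsHardThresh s (fun i => (W0 * P) i j) (fun i => Z1 i j)) :
    frobNorm (Z1 - Zstar) ≤ 2 * frobNorm (W0 - Wstar) := by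
  have hWP : Wstar * P = Zstar := by
    rw [hP, ← Matrix.mul_assoc, mul_eq_one_comm.mp hWorth, Matrix.one_mul]
  have hE : W0 * P - Zstar = (W0 - Wstar) * P := by rw [Matrix.sub_mul, hWP]
  have hF : ∑ i, ∑ j, ((W0 * P) i j - Zstar i j) ^ 2 ≤ ∑ i, ∑ j, (W0 - Wstar) i j ^ 2 := by
    have h := sum_sq_mul_le (W0 - Wstar) P
    rw [hPnorm, one_pow, one_mul, ← hE] at h
    exact h
  have hZ : ∑ i, ∑ j, (Z1 i j - (W0 * P) i j) ^ 2 ≤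
      ∑ i, ∑ j, ((W0 * P) i j - Zstar i j) ^ 2 := by
    rw [Finset.sum_comm, Finset.sum_comm (f := fun i j => ((W0 * P) i j - Zstar i j) ^ 2)]
    exact Finset.sum_le_sum fun j _ => (hZ1 j).sum_sq_sub_le (hcols j)
  have hsplit : ∑ i, ∑ j, (Z1 - Zstar) i j ^ 2 ≤
      2 * ∑ i, ∑ j, (Z1 i j - (W0 * P) i j) ^ 2 +
        2 * ∑ i, ∑ j, ((W0 * P) i j - Zstar i j) ^ 2 := by
    simp only [Finset.mul_sum, ← Finset.sum_add_distrib]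
    refine Finset.sum_le_sum fun i _ => Finset.sum_le_sum fun j _ => ?_
    rw [Matrix.sub_apply]
    nlinarith [sq_nonneg ((Z1 i j - (W0 * P) i j) - ((W0 * P) i j - Zstar i j))]
  unfold frobNorm
  refine Real.sqrt_le_iff.mpr ⟨by positivity, ?_⟩
  rw [mul_pow, Real.sq_sqrt (by positivity)]
  linarith
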